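/- Let P and Q be nonzero integers with D = P^2 - 4Q ≠ 0, let U = U(P,Q) and V = V(P,Q) be nondegenerate, and let p be an odd prime with p ∤ D and p ∤ gcd(P,Q). Suppose the entry point of p in U equals 2n where n is odd and gcd(p,n) = 1 (i.e. p ∣ U_{2n} and p ∤ U_m for all 1 ≤ m < 2n). Then for every integer k ≥ 1 there exist integers a, b with p ∤ b such that M^V_{p^k n} = (D/p)·p + p^{k+1}·(a/b), where (D/p) is the Legendre symbol. -/

import Mathlib

/-- Lucas sequence of the first kind: `U 0 = 0`, `U 1 = 1`,
`U (n+2) = P * U (n+1) - Q * U n`. -/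
def lucasU (P Q : ℤ) : ℕ → ℤ
  | 0 => 0
  | 1 => 1
  | n + 2 => P * lucasU P Q (n + 1) - Q * lucasU P Q n

/-- Lucas sequence of the second kind: `V 0 = 2`, `V 1 = P`,
`V (n+2) = P * V (n+1) - Q * V n`. -/
def lucasV (P Q : ℤ) : ℕ → ℤ
  | 0 => 2
  | 1 => P
  | n + 2 => P * lucasV P Q (n + 1) - Q * lucasV P Q n

/-- Möbius dual of the Lucas sequence of the second kind:
`M^V_n = ∏_{d ∣ n} V_d ^ μ(n/d)`, as a rational number. -/
def mobiusDualV (P Q : ℤ) (n : ℕ) : ℚ :=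
  ∏ d ∈ n.divisors, (lucasV P Q d : ℚ) ^ (ArithmeticFunction.moebius (n / d))

lemma lucasV_eq (P Q : ℤ) (a b : ℂ) (h1 : a + b = P) (h2 : a * b = Q) (n : ℕ) :
    (lucasV P Q n : ℂ) = a ^ n + b ^ n := by
  induction n using Nat.strong_induction_on with
  | _ n ih =>
    match n with
    | 0 => simp [lucasV]; norm_num
    | 1 => simp [lucasV, h1]
    | n + 2 =>
      rw [lucasV]
      push_cast
      rw [ih (n+1) (by omega), ih n (by omega), ← h1, ← h2]
      ring

lemma lucasU_eq (P Q : ℤ) (a b : ℂ) (h1 : a + b = P) (h2 : a * b = Q) (n : ℕ) :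
    (lucasU P Q n : ℂ) * (a - b) = a ^ n - b ^ n := by
  induction n using Nat.strong_induction_on with
  | _ n ih =>
    match n with
    | 0 => simp [lucasU]
    | 1 => simp [lucasU]
    | n + 2 =>
      rw [lucasU]
      push_cast
      have e1 := ih (n+1) (by omega)
      have e2 := ih n (by omega)
      rw [← h1, ← h2]
      linear_combination (a + b) * e1 - a * b * e2

lemma exists_roots (P Q : ℤ) : ∃ a b : ℂ, a + b = P ∧ a * b = Q := by
  obtain ⟨s, hs⟩ := IsAlgClosed.exists_pow_nat_eq ((P : ℂ) ^ 2 - 4 * Q) (n := 2) (by norm_num)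
  exact ⟨(P + s) / 2, (P - s) / 2, by ring, by linear_combination -hs / 4⟩

lemma lucasV_mul (P Q : ℤ) (r m : ℕ) :
    lucasV P Q (m * r) = lucasV (lucasV P Q m) (Q ^ m) r := by
  obtain ⟨a, b, h1, h2⟩ := exists_roots P Q
  have e1 := lucasV_eq P Q a b h1 h2 m
  have e2 := lucasV_eq P Q a b h1 h2 (m * r)
  have e3 := lucasV_eq (lucasV P Q m) (Q ^ m) (a ^ m) (b ^ m) e1.symm
    (by push_cast; rw [← h2]; ring) r
  have : (lucasV P Q (m * r) : ℂ) = lucasV (lucasV P Q m) (Q ^ m) r := by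
    rw [e2, e3]; ring
  exact_mod_cast this

lemma lucasU_two_mul (P Q : ℤ) (hD : P ^ 2 - 4 * Q ≠ 0) (n : ℕ) :
    lucasU P Q (2 * n) = lucasU P Q n * lucasV P Q n := by
  obtain ⟨a, b, h1, h2⟩ := exists_roots P Q
  have e1 := lucasV_eq P Q a b h1 h2 n
  have e2 := lucasU_eq P Q a b h1 h2 (2 * n)
  have e3 := lucasU_eq P Q a b h1 h2 n
  have hab : a - b ≠ 0 := by
    intro h
    apply hD
    have : ((P : ℂ) ^ 2 - 4 * Q) = 0 := by
      rw [← h1, ← h2]; linear_combination (a - b) * h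
    exact_mod_cast this
  have : (lucasU P Q (2 * n) : ℂ) = lucasU P Q n * lucasV P Q n := by
    apply mul_right_cancel₀ hab
    rw [e2, mul_right_comm, e3, e1]; ring
  exact_mod_cast this

lemma lucasV_sq (P Q : ℤ) (n : ℕ) :
    lucasV P Q n ^ 2 - (P ^ 2 - 4 * Q) * lucasU P Q n ^ 2 = 4 * Q ^ n := by
  obtain ⟨a, b, h1, h2⟩ := exists_roots P Q
  have e1 := lucasV_eq P Q a b h1 h2 n
  have e3 := lucasU_eq P Q a b h1 h2 n
  have : (lucasV P Q n : ℂ) ^ 2 - (P ^ 2 - 4 * Q) * lucasU P Q n ^ 2 = 4 * Q ^ n := by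
    have : ((P : ℂ) ^ 2 - 4 * Q) = (a - b) ^ 2 := by rw [← h1, ← h2]; ring
    rw [this, ← mul_pow, mul_comm (a - b), e3, e1, ← h2]
    ring
  exact_mod_cast this

lemma lucasV_odd (P Q : ℤ) (h : ℕ) :
    ∃ c, lucasV P Q (2 * h + 1) = P * ((2 * h + 1) * (-Q) ^ h + P ^ 2 * c) := by
  induction h using Nat.strong_induction_on with
  | _ h ih =>
    match h with
    | 0 => exact ⟨0, by simp [lucasV]⟩
    | 1 => exact ⟨1, by simp [lucasV]; ring⟩
    | h + 2 =>
      obtain ⟨c1, e1⟩ := ih (h + 1) (by omega)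
      obtain ⟨c0, e0⟩ := ih h (by omega)
      have key : lucasV P Q (2 * (h + 2) + 1) =
          (P ^ 2 - 2 * Q) * lucasV P Q (2 * (h + 1) + 1) - Q ^ 2 * lucasV P Q (2 * h + 1) := by
        show lucasV P Q (2 * h + 1 + 2 + 2) = _ * lucasV P Q (2 * h + 1 + 2) - _
        simp only [lucasV]
        ring
      refine ⟨(2 * (h + 1) + 1) * (-Q) ^ (h + 1) + (P ^ 2 - 2 * Q) * c1 - Q ^ 2 * c0, ?_⟩
      rw [key, e1, e0]
      push_cast
      ring

lemma lucasV_congr (N P Q P' Q' : ℤ) (h1 : P ≡ P' [ZMOD N]) (h2 : Q ≡ Q' [ZMOD N]) (n : ℕ) :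
    lucasV P Q n ≡ lucasV P' Q' n [ZMOD N] := by
  induction n using Nat.strong_induction_on with
  | _ n ih =>
    match n with
    | 0 => rfl
    | 1 => simpa [lucasV] using h1
    | n + 2 =>
      simp only [lucasV]
      exact (h1.mul (ih (n+1) (by omega))).sub (h2.mul (ih n (by omega)))

/-- symmetric monomial sum `x^i y^j + x^j y^i` -/
def symT (P Q : ℤ) (i j : ℕ) : ℤ :=
  Q ^ min i j * lucasV P Q (max i j - min i j)

lemma symT_eq (P Q : ℤ) (a b : ℂ) (h1 : a + b = P) (h2 : a * b = Q) (i j : ℕ) :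
    (symT P Q i j : ℂ) = a ^ i * b ^ j + a ^ j * b ^ i := by
  unfold symT
  push_cast
  rw [lucasV_eq P Q a b h1 h2, ← h2]
  rcases le_total i j with h | h
  · obtain ⟨t, rfl⟩ := Nat.exists_eq_add_of_le h
    simp
    ring
  · obtain ⟨t, rfl⟩ := Nat.exists_eq_add_of_le h
    simp
    ring

lemma lucasV_prime (P Q : ℤ) (p : ℕ) (hp : p.Prime) :
    2 * P ^ p = 2 * lucasV P Q p + p * (Q * ∑ k ∈ Finset.Ioo 0 p,
      (p.choose k / p : ℕ) * symT P Q (k - 1) (p - k - 1)) := by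
  obtain ⟨a, b, h1, h2⟩ := exists_roots P Q
  have e := add_pow_prime_eq hp a b
  have e' := add_pow_prime_eq hp b a
  have : (2 * P ^ p : ℂ) = 2 * lucasV P Q p + p * (Q * ∑ k ∈ Finset.Ioo 0 p,
      (p.choose k / p : ℕ) * (symT P Q (k - 1) (p - k - 1) : ℂ)) := by
    simp only [symT_eq P Q a b h1 h2, lucasV_eq P Q a b h1 h2]
    have hs : ∑ k ∈ Finset.Ioo 0 p, ((p.choose k / p : ℕ) : ℂ) *
        (a ^ (k - 1) * b ^ (p - k - 1) + a ^ (p - k - 1) * b ^ (k - 1)) =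
        ∑ k ∈ Finset.Ioo 0 p, a ^ (k - 1) * b ^ (p - k - 1) * ((p.choose k / p : ℕ) : ℂ) +
        ∑ k ∈ Finset.Ioo 0 p, b ^ (k - 1) * a ^ (p - k - 1) * ((p.choose k / p : ℕ) : ℂ) := by
      rw [← Finset.sum_add_distrib]
      apply Finset.sum_congr rfl
      intros; ring
    rw [hs, ← h1, ← h2]
    rw [add_comm b a] at e'
    linear_combination e + e'
  apply Int.cast_injective (α := ℂ)
  push_cast
  push_cast at this
  exact this

lemma symT_congr (N P Q P' Q' : ℤ) (h1 : P ≡ P' [ZMOD N]) (h2 : Q ≡ Q' [ZMOD N]) (i j : ℕ) :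
    symT P Q i j ≡ symT P' Q' i j [ZMOD N] :=
  (h2.pow _).mul (lucasV_congr N P Q P' Q' h1 h2 _)

lemma pow_prime_congr (p : ℕ) (j : ℕ) (x y : ℤ)
    (h : x ≡ y [ZMOD (p : ℤ) ^ (j + 1)]) : x ^ p ≡ y ^ p [ZMOD (p : ℤ) ^ (j + 2)] := by
  obtain ⟨t, ht⟩ := (Int.modEq_iff_dvd.mp h)
  obtain rfl : y = x + p ^ (j + 1) * t := by linarith
  clear h ht
  apply Int.ModEq.symm
  rw [Int.modEq_iff_dvd]
  obtain ⟨c, hc⟩ : ∃ c, (x + p ^ (j + 1) * t) ^ p =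
      x ^ p + p * x ^ (p - 1) * (p ^ (j + 1) * t) + c * (p ^ (j + 1) * t) ^ 2 := by
    obtain ⟨c, hc⟩ := Polynomial.powAddExpansion x (p ^ (j + 1) * t) p
    exact ⟨c, by rw [hc]⟩
  rw [hc]
  exact ⟨-(x ^ (p - 1) * t) - c * p ^ j * t ^ 2, by ring⟩

lemma lucasV_prime_congr (p : ℕ) (hp : p.Prime) (hodd : Odd p) (j : ℕ) (P Q P' Q' : ℤ)
    (h1 : P ≡ P' [ZMOD (p : ℤ) ^ (j + 1)]) (h2 : Q ≡ Q' [ZMOD (p : ℤ) ^ (j + 1)]) :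
    lucasV P Q p ≡ lucasV P' Q' p [ZMOD (p : ℤ) ^ (j + 2)] := by
  have e := lucasV_prime P Q p hp
  have e' := lucasV_prime P' Q' p hp
  have hpow := (pow_prime_congr p j P P' h1).mul_left 2
  set S := Q * ∑ k ∈ Finset.Ioo 0 p,
      ((p.choose k / p : ℕ) : ℤ) * symT P Q (k - 1) (p - k - 1) with hS
  set S' := Q' * ∑ k ∈ Finset.Ioo 0 p,
      ((p.choose k / p : ℕ) : ℤ) * symT P' Q' (k - 1) (p - k - 1) with hS'
  have hSS : S ≡ S' [ZMOD (p : ℤ) ^ (j + 1)] := by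
    apply h2.mul
    rw [Int.modEq_iff_dvd, ← Finset.sum_sub_distrib]
    apply Finset.dvd_sum
    intro k _
    exact Int.modEq_iff_dvd.mp ((symT_congr _ P Q P' Q' h1 h2 _ _).mul_left _)
  have hpS : p * S ≡ p * S' [ZMOD (p : ℤ) ^ (j + 2)] := by
    have := hSS.mul_left' (c := (p : ℤ))
    rwa [← pow_succ'] at this
  have h2V : 2 * lucasV P Q p ≡ 2 * lucasV P' Q' p [ZMOD (p : ℤ) ^ (j + 2)] := by
    have := hpow.sub hpS
    rw [e, e'] at this
    simpa using this
  rw [Int.modEq_iff_dvd] at h2V ⊢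
  rw [← mul_sub] at h2V
  refine IsCoprime.dvd_of_dvd_mul_left ?_ h2V
  apply IsCoprime.pow_left
  rw [Int.isCoprime_iff_gcd_eq_one]
  have : Nat.Coprime p 2 := hodd.coprime_two_right
  exact_mod_cast this

lemma gauss_congr (p : ℕ) (hp : p.Prime) (hodd : Odd p) (P Q : ℤ) (m j : ℕ) :
    lucasV P Q (m * p ^ (j + 1)) ≡ lucasV P Q (m * p ^ j) [ZMOD (p : ℤ) ^ (j + 1)] ∧
    Q ^ (m * p ^ (j + 1)) ≡ Q ^ (m * p ^ j) [ZMOD (p : ℤ) ^ (j + 1)] := by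
  have := Fact.mk hp
  have fermat : ∀ x : ℤ, x ^ p ≡ x [ZMOD p] := by
    intro x
    rw [← ZMod.intCast_eq_intCast_iff]
    push_cast
    exact ZMod.pow_card _
  induction j with
  | zero =>
    simp only [zero_add, pow_one, pow_zero, mul_one]
    constructor
    · rw [lucasV_mul]
      set R := lucasV P Q m
      refine Int.ModEq.trans ?_ (fermat R)
      have e := lucasV_prime R (Q ^ m) p hp
      have hcop : IsCoprime (p : ℤ) 2 := by
        rw [Int.isCoprime_iff_gcd_eq_one]
        have : Nat.Coprime p 2 := hodd.coprime_two_right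
        exact_mod_cast this
      rw [Int.modEq_iff_dvd]
      refine hcop.dvd_of_dvd_mul_left (?_ : (p : ℤ) ∣ 2 * _)
      rw [mul_sub, e, add_sub_cancel_left]
      exact Dvd.intro _ rfl
    · rw [pow_mul]; exact fermat _
  | succ j ih =>
    have e1 : m * p ^ (j + 1 + 1) = m * p ^ (j + 1) * p := by ring
    have e2 : m * p ^ (j + 1) = m * p ^ j * p := by ring
    constructor
    · rw [e1, lucasV_mul]
      conv_rhs => rw [e2, lucasV_mul]
      exact lucasV_prime_congr p hp hodd j _ _ _ _ ih.1 ih.2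
    · rw [e1, pow_mul]
      conv_rhs => rw [e2, pow_mul]
      exact pow_prime_congr p j _ _ ih.2

lemma not_dvd_of (p : ℕ) (hp : p.Prime) (hodd : Odd p) (P Q : ℤ) (m j : ℕ)
    (h : ¬ (p : ℤ) ∣ lucasV P Q m) : ¬ (p : ℤ) ∣ lucasV P Q (m * p ^ j) := by
  induction j with
  | zero => simpa using h
  | succ j ih =>
    intro hd
    apply ih
    have := ((gauss_congr p hp hodd P Q m j).1).of_dvd (dvd_pow_self (p : ℤ) (Nat.succ_ne_zero j))
    exact (Int.ModEq.dvd_iff this).mp hd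

lemma step_n (p : ℕ) (hodd : Odd p) (P Q : ℤ) (m : ℕ) :
    ∃ c, lucasV P Q (m * p) = lucasV P Q m *
      (p * (-Q ^ m) ^ (p / 2) + lucasV P Q m ^ 2 * c) := by
  obtain ⟨h, rfl⟩ := hodd
  rw [lucasV_mul]
  obtain ⟨c, hc⟩ := lucasV_odd (lucasV P Q m) (Q ^ m) h
  refine ⟨c, ?_⟩
  rw [hc, show (2 * h + 1) / 2 = h by omega]
  push_cast
  rfl

lemma dvd_Vn (p : ℕ) (hodd : Odd p) (P Q : ℤ) (n j : ℕ)
    (h : (p : ℤ) ∣ lucasV P Q n) : (p : ℤ) ^ (j + 1) ∣ lucasV P Q (n * p ^ j) := by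
  induction j with
  | zero => simpa using h
  | succ j ih =>
    rw [pow_succ p j, ← mul_assoc]
    obtain ⟨c, hc⟩ := step_n p hodd P Q (n * p ^ j)
    rw [hc, pow_succ]
    apply mul_dvd_mul ih
    apply dvd_add (Dvd.intro _ rfl)
    apply Dvd.dvd.mul_right
    apply dvd_pow _ two_ne_zero
    exact (dvd_pow_self _ (Nat.succ_ne_zero j)).trans ih

lemma sign_congr (P Q : ℤ) (p : ℕ) (hp : p.Prime) (hodd : Odd p) (n j : ℕ)
    (hV : (p : ℤ) ∣ lucasV P Q n) (hU : ¬ (p : ℤ) ∣ lucasU P Q n) :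
    (p : ℤ) ^ (j + 1) ∣ (-Q ^ (n * p ^ j)) ^ (p / 2) - jacobiSym (P ^ 2 - 4 * Q) p := by
  have := Fact.mk hp
  have h0 : (p : ℤ) ∣ (-Q ^ n) ^ (p / 2) - jacobiSym (P ^ 2 - 4 * Q) p := by
    rw [← jacobiSym.legendreSym.to_jacobiSym, ← ZMod.intCast_zmod_eq_zero_iff_dvd]
    have e := legendreSym.eq_pow p (P ^ 2 - 4 * Q)
    push_cast at e ⊢
    rw [e, sub_eq_zero]
    have hs := congrArg (Int.cast : ℤ → ZMod p) (lucasV_sq P Q n)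
    rw [← ZMod.intCast_zmod_eq_zero_iff_dvd] at hV hU
    push_cast at hs
    rw [hV] at hs
    have hp2 : 2 * (p / 2) = p - 1 := by obtain ⟨h, rfl⟩ := hodd; omega
    have h2 : (2 : ZMod p) ≠ 0 := by
      have : ((2 : ℕ) : ZMod p) ≠ 0 := by
        rw [Ne, ZMod.natCast_eq_zero_iff]
        intro hd
        have := (Nat.prime_dvd_prime_iff_eq hp Nat.prime_two).mp hd
        subst this
        exact absurd hodd (by decide)
      simpa using this
    have q1 : (2 : ZMod p) ^ (2 * (p / 2)) = 1 := by rw [hp2]; exact ZMod.pow_card_sub_one_eq_one h2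
    have q2 : (lucasU P Q n : ZMod p) ^ (2 * (p / 2)) = 1 := by
      rw [hp2]; exact ZMod.pow_card_sub_one_eq_one hU
    have hs' : (2 : ZMod p) ^ 2 * (-(Q : ZMod p) ^ n) =
      ((P : ZMod p) ^ 2 - 4 * Q) * (lucasU P Q n : ZMod p) ^ 2 := by linear_combination hs
    have := congrArg (· ^ (p / 2)) hs'
    simp only [mul_pow, ← pow_mul] at this
    rw [q1, q2] at this
    simpa [mul_pow, ← pow_mul] using this
  have h1 := dvd_sub_pow_of_dvd_sub h0 j
  have hJ : (jacobiSym (P ^ 2 - 4 * Q) p) ^ (p ^ j) = jacobiSym (P ^ 2 - 4 * Q) p := by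
    have hpj : Odd (p ^ j) := hodd.pow
    rcases jacobiSym.trichotomy (P ^ 2 - 4 * Q) p with h | h | h <;> rw [h]
    · exact zero_pow hpj.pos.ne'
    · simp
    · exact hpj.neg_one_pow
  rw [hJ] at h1
  have : (-Q ^ (n * p ^ j)) ^ (p / 2) = ((-Q ^ n) ^ (p / 2)) ^ (p ^ j) := by
    rw [← pow_mul, mul_comm (p / 2), pow_mul, pow_mul, (hodd.pow).neg_pow]
  rw [this]
  exact h1

/-- rationals congruent to 1 mod p^k -/
def OneMod (p k : ℕ) (x : ℚ) : Prop :=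
  ∃ a b : ℤ, ¬ (p : ℤ) ∣ b ∧ x = 1 + (p : ℚ) ^ k * ((a : ℚ) / b)

lemma OneMod.one (p k : ℕ) (hp : p.Prime) : OneMod p k 1 :=
  ⟨0, 1, by
    intro h
    exact hp.one_lt.ne' (by exact_mod_cast Int.eq_one_of_dvd_one (by positivity) h), by simp⟩

lemma ne_zero_of_not_dvd {p : ℕ} {b : ℤ} (h : ¬ (p : ℤ) ∣ b) : (b : ℚ) ≠ 0 := by
  intro h0
  apply h
  rw [Int.cast_eq_zero] at h0
  simp [h0]

lemma OneMod.mul {p k : ℕ} (hp : p.Prime) {x y : ℚ} (hx : OneMod p k x) (hy : OneMod p k y) :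
    OneMod p k (x * y) := by
  obtain ⟨a, b, hb, rfl⟩ := hx
  obtain ⟨c, d, hd, rfl⟩ := hy
  have hb' := ne_zero_of_not_dvd hb
  have hd' := ne_zero_of_not_dvd hd
  refine ⟨a * d + c * b + p ^ k * a * c, b * d, ?_, ?_⟩
  · intro h
    rcases (Nat.prime_iff_prime_int.mp hp).dvd_or_dvd h with h | h
    exacts [hb h, hd h]
  · push_cast
    field_simp
    ring

lemma OneMod.inv {p k : ℕ} (hk : 1 ≤ k) {x : ℚ} (hx : OneMod p k x) :
    OneMod p k x⁻¹ := by
  obtain ⟨a, b, hb, rfl⟩ := hx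
  have hb' := ne_zero_of_not_dvd hb
  have hn : ¬ (p : ℤ) ∣ b + p ^ k * a := by
    intro h
    apply hb
    have : (p : ℤ) ∣ p ^ k * a := (dvd_pow_self _ (by omega)).mul_right _
    exact (dvd_add_left this).mp h
  have hn' := ne_zero_of_not_dvd hn
  refine ⟨-a, b + p ^ k * a, hn, ?_⟩
  have e : 1 + (p : ℚ) ^ k * ((a : ℚ) / b) = ((b + p ^ k * a : ℤ) : ℚ) / b := by
    push_cast; field_simp
  rw [e, inv_div]
  rw [div_eq_iff hn', add_mul, mul_div_assoc', div_mul_cancel₀ _ hn']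
  push_cast
  ring

lemma OneMod.zpow {p k : ℕ} (hp : p.Prime) (hk : 1 ≤ k) {x : ℚ} (hx : OneMod p k x) (z : ℤ) :
    OneMod p k (x ^ z) := by
  have hnat : ∀ t : ℕ, OneMod p k (x ^ t) := by
    intro t
    induction t with
    | zero => simpa using OneMod.one p k hp
    | succ t ih => rw [pow_succ]; exact ih.mul hp hx
  cases z with
  | ofNat t => simpa using hnat t
  | negSucc t => rw [zpow_negSucc]; exact (hnat _).inv hk

lemma mobius_split (P Q : ℤ) (p : ℕ) (hp : p.Prime) (n : ℕ) (hpn : Nat.Coprime p n) (j : ℕ) :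
    mobiusDualV P Q (p ^ (j + 1) * n) = ∏ d ∈ n.divisors,
      ((lucasV P Q (d * p ^ (j + 1)) : ℚ) / lucasV P Q (d * p ^ j)) ^
        (ArithmeticFunction.moebius (n / d)) := by
  unfold mobiusDualV
  have hc : Nat.Coprime (p ^ (j + 1)) n := hpn.pow_left _
  rw [Nat.divisors_mul, Finset.mul_def, Finset.prod_image hc.mul_injOn_divisors,
    Finset.prod_product_right]
  apply Finset.prod_congr rfl
  intro d hd
  have hdn : d ∣ n := Nat.dvd_of_mem_divisors hd
  have hn0 : n ≠ 0 := (Nat.mem_divisors.mp hd).2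
  have hd0 : 0 < d := Nat.pos_of_mem_divisors hd
  rw [Nat.prod_divisors_prime_pow hp]
  have hmu : ∀ x ∈ Finset.range (j + 1 + 1),
      ArithmeticFunction.moebius (p ^ (j + 1) * n / (p ^ x * d)) =
      ArithmeticFunction.moebius (p ^ (j + 1 - x)) * ArithmeticFunction.moebius (n / d) := by
    intro x hx
    have hx' : x ≤ j + 1 := by simpa [Nat.lt_succ_iff] using hx
    rw [Nat.mul_div_mul_comm (pow_dvd_pow p hx') hdn, Nat.pow_div hx' hp.pos]
    apply ArithmeticFunction.isMultiplicative_moebius.map_mul_of_coprime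
    exact (hpn.pow_left _).coprime_dvd_right (Nat.div_dvd_of_dvd hdn)
  rw [Finset.prod_congr rfl (fun x hx => by rw [hmu x hx]),
    Finset.prod_range_succ, Finset.prod_range_succ, Finset.prod_eq_one]
  · have e1 : j + 1 - j = 1 := by omega
    rw [e1, Nat.sub_self, pow_one, ArithmeticFunction.moebius_apply_prime hp, pow_zero,
      ArithmeticFunction.moebius_apply_one, one_mul, one_mul, neg_one_mul, zpow_neg, div_zpow,
      mul_comm d, mul_comm d, div_eq_mul_inv, mul_comm]
  · intro x hx
    have hx' : x < j := by simpa using hx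
    rw [ArithmeticFunction.moebius_apply_prime_pow hp (by omega), if_neg (by omega)]
    simp

theorem stmt_7 (P Q : ℤ) (hP : P ≠ 0) (hQ : Q ≠ 0) (hD : P ^ 2 - 4 * Q ≠ 0)
    (hndU : ∀ m : ℕ, 1 ≤ m → lucasU P Q m ≠ 0)
    (hndV : ∀ m : ℕ, 1 ≤ m → lucasV P Q m ≠ 0)
    (p : ℕ) (hp : p.Prime) (hodd : Odd p) (hpD : ¬ (p : ℤ) ∣ (P ^ 2 - 4 * Q))
    (hpPQ : ¬ p ∣ Int.gcd P Q)
    (n : ℕ) (hnodd : Odd n) (hpn : Nat.gcd p n = 1)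
    (hz : (p : ℤ) ∣ lucasU P Q (2 * n) ∧
      ∀ m : ℕ, 1 ≤ m → m < 2 * n → ¬ (p : ℤ) ∣ lucasU P Q m)
    (k : ℕ) (hk : 1 ≤ k) :
    ∃ a b : ℤ, ¬ (p : ℤ) ∣ b ∧
      mobiusDualV P Q (p ^ k * n)
        = (jacobiSym (P ^ 2 - 4 * Q) p : ℚ) * (p : ℚ)
          + (p : ℚ) ^ (k + 1) * ((a : ℚ) / (b : ℚ)) := by
  obtain ⟨j, rfl⟩ : ∃ j, k = j + 1 := ⟨k - 1, by omega⟩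
  clear hk
  have hpi := Nat.prime_iff_prime_int.mp hp
  have hn1 : 1 ≤ n := hnodd.pos
  have hUn : ¬ (p : ℤ) ∣ lucasU P Q n := hz.2 n hn1 (by omega)
  have hVn : (p : ℤ) ∣ lucasV P Q n := by
    have h := hz.1
    rw [lucasU_two_mul P Q hD] at h
    exact (hpi.dvd_or_dvd h).resolve_left hUn
  rw [mobius_split P Q p hp n hpn j, ← Nat.cons_self_properDivisors (by omega), Finset.prod_cons]
  have hone : OneMod p (j + 1) (∏ d ∈ n.properDivisors,
      ((lucasV P Q (d * p ^ (j + 1)) : ℚ) / lucasV P Q (d * p ^ j)) ^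
        (ArithmeticFunction.moebius (n / d))) := by
    apply Finset.prod_induction _ (OneMod p (j + 1)) (fun a b => OneMod.mul hp)
      (OneMod.one p _ hp)
    intro d hd
    apply OneMod.zpow hp (by omega)
    have hdn := Nat.mem_properDivisors.mp hd
    have hd1 : 1 ≤ d := Nat.pos_of_dvd_of_pos hdn.1 hn1
    have hVd : ¬ (p : ℤ) ∣ lucasV P Q d := by
      intro h
      apply hz.2 (2 * d) (by omega) (by omega)
      rw [lucasU_two_mul P Q hD]
      exact h.mul_left _
    have hb := not_dvd_of p hp hodd P Q d j hVd
    have hb' := ne_zero_of_not_dvd hb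
    obtain ⟨t, ht⟩ := Int.modEq_iff_dvd.mp (gauss_congr p hp hodd P Q d j).1.symm
    refine ⟨t, _, hb, ?_⟩
    have ht' : (lucasV P Q (d * p ^ (j + 1)) : ℚ) =
        lucasV P Q (d * p ^ j) + p ^ (j + 1) * t := by
      have := congrArg (Int.cast : ℤ → ℚ) ht
      push_cast at this
      linarith
    rw [ht']
    field_simp
  obtain ⟨a, b, hb, hab⟩ := hone
  have hb' := ne_zero_of_not_dvd hb
  rw [hab, Nat.div_self hn1, ArithmeticFunction.moebius_apply_one, zpow_one]
  obtain ⟨c, hc⟩ := step_n p hodd P Q (n * p ^ j)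
  obtain ⟨v, hv⟩ := dvd_Vn p hodd P Q n j hVn
  obtain ⟨s, hs⟩ := sign_congr P Q p hp hodd n j hVn hUn
  have hV0 : (lucasV P Q (n * p ^ j) : ℚ) ≠ 0 := by
    exact_mod_cast hndV _ (Nat.mul_pos hn1 (pow_pos hp.pos _))
  set J := jacobiSym (P ^ 2 - 4 * Q) p
  have hr : (lucasV P Q (n * p ^ (j + 1)) : ℚ) / lucasV P Q (n * p ^ j) =
      p * J + p ^ (j + 2) * (s + p ^ j * v ^ 2 * c : ℤ) := by
    rw [div_eq_iff hV0, pow_succ p j, ← mul_assoc, hc]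
    have hs' : (-Q ^ (n * p ^ j)) ^ (p / 2) = J + p ^ (j + 1) * s := by linarith
    rw [hs']
    have h2 : lucasV P Q (n * p ^ j) ^ 2 = (p ^ (j + 1) * v) ^ 2 := by rw [hv]
    rw [h2]
    push_cast
    ring
  rw [hr]
  generalize s + (p : ℤ) ^ j * v ^ 2 * c = t
  refine ⟨t * b + J * a + p ^ (j + 1) * t * a, b, hb, ?_⟩
  push_cast
  field_simp
  ring
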